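/- arXiv:1906.07636 — 3 statements merged into one kernel-verified Lean document; each statement's English description precedes it below -/
import Mathlib

section
/- For a commutative ring R, an element t ∈ R, a natural number s ≥ 1, and variables ε₁,…,ε_s ∈ R, the antisymmetrization ∑_{σ ∈ S_s} sgn(σ) ∏_{1≤j<k≤s} (ε_{σ(j)} − t²·ε_{σ(k)}) equals (∏_{j=1}^{s} (1 + t² + t⁴ + ⋯ + t^{2(j−1)})) · ∏_{1≤j<k≤s} (ε_j − ε_k). -/
open Finset

theorem Fin.sum_perm_succ_sign_mul {R : Type*} [CommRing R] {n : ℕ}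
    (G : Fin (n + 1) → (Fin n → Fin (n + 1)) → R) :
    ∑ σ : Equiv.Perm (Fin (n + 1)), ((Equiv.Perm.sign σ : ℤ) : R) * G (σ 0) (fun k ↦ σ k.succ) =
      ∑ p : Fin (n + 1), (-1) ^ (p : ℕ) * ∑ τ : Equiv.Perm (Fin n),
        ((Equiv.Perm.sign τ : ℤ) : R) * G p (fun k ↦ p.succAbove (τ k)) := by
  rw [univ_perm_fin_succ, ← univ_product_univ]
  simp only [sum_map, Equiv.toEmbedding_apply, sum_product,
    Equiv.Perm.decomposeFin_symm_apply_zero, Equiv.Perm.decomposeFin_symm_apply_succ,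
    Equiv.Perm.decomposeFin.symm_sign]
  refine sum_congr rfl fun p _ ↦ ?_
  cases p using Fin.cases with
  | zero => simp
  | succ i =>
    rw [mul_sum]
    refine Eq.trans ?_ (Equiv.sum_comp (Equiv.mulLeft i.cycleRange) _)
    refine sum_congr rfl fun σ _ ↦ ?_
    have h : ((-1 : R) ^ (i : ℕ)) * (-1) ^ (i : ℕ) = 1 := by
      rw [← mul_pow]; simp
    simp only [Fin.succ_ne_zero, if_false, Equiv.coe_mulLeft, Equiv.Perm.sign_mul,
      Fin.sign_cycleRange, Equiv.Perm.mul_apply, Fin.succAbove_cycleRange, Fin.val_succ]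
    push_cast
    linear_combination (((Equiv.Perm.sign σ : ℤ) : R) *
      G i.succ (fun k ↦ Equiv.swap 0 i.succ (σ k).succ)) * h

namespace Polynomial

theorem scaleRoots_prod_X_sub_C {R ι : Type*} [CommRing R] (s : Finset ι) (y : ι → R) (q : R) :
    (∏ k ∈ s, (X - C (y k))).scaleRoots q = ∏ k ∈ s, (X - C (q * y k)) := by
  classical
  nontriviality R
  induction s using Finset.induction_on with
  | empty => simp
  | insert a s ha ih =>
    rw [prod_insert ha, prod_insert ha, mul_scaleRoots', ih]
    · have h := X_add_C_scaleRoots (-y a) q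
      rw [neg_mul, C_neg, C_neg, ← sub_eq_add_neg, ← sub_eq_add_neg, mul_comm (y a)] at h
      rw [h]
    · rw [leadingCoeff_X_sub_C, (monic_prod_X_sub_C y s).leadingCoeff]
      simp

theorem prod_sub_mul_eq_sum_coeff {R : Type*} [CommRing R] {n : ℕ} (x q : R) (y : Fin n → R) :
    ∏ k, (x - q * y k) =
      ∑ j ∈ range (n + 1), (∏ k, (X - C (y k))).coeff j * q ^ (n - j) * x ^ j := by
  nontriviality R
  have hdeg : (∏ k, (X - C (y k))).natDegree = n := by simp
  have h := congrArg (eval x) (scaleRoots_prod_X_sub_C univ y q)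
  rw [eval_eq_sum_range, natDegree_scaleRoots, hdeg] at h
  simpa [coeff_scaleRoots, hdeg, eval_prod] using h.symm

/-- The product `∏_{k ≠ p} (x_p - q x_k)` is the value at `x_p` of a polynomial independent of `p`,
whose coefficients are those of `∏_k (X - x_k)` weighted by powers of `q` and `q`-integers. -/
theorem prod_sub_mul_succAbove_eq_sum_coeff {R : Type*} [CommRing R] {n : ℕ} (q : R)
    (x : Fin (n + 1) → R) (p : Fin (n + 1)) :
    ∏ k, (x p - q * x (p.succAbove k)) =
      ∑ j ∈ range (n + 1), (∑ i ∈ range (j + 1), q ^ i) * q ^ (n - j) *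
        (∏ k, (X - C (x k))).coeff (j + 1) * x p ^ j := by
  nontriviality R
  set Ψ : R[X] := ∏ k, (X - C (x (p.succAbove k))) with hΨ
  have hcoeff (j : ℕ) :
      (∏ k, (X - C (x k))).coeff (j + 1) = Ψ.coeff j - x p * Ψ.coeff (j + 1) := by
    rw [Fin.prod_univ_succAbove _ p, ← hΨ, sub_mul, coeff_sub, coeff_X_mul, coeff_C_mul]
  have htop : Ψ.coeff (n + 1) = 0 := coeff_eq_zero_of_natDegree_lt (by simp [hΨ])
  let T (j : ℕ) : R := (∑ i ∈ range j, q ^ i) * q ^ (n + 1 - j) * Ψ.coeff j * x p ^ j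
  have hT : ∑ j ∈ range (n + 1), (T (j + 1) - T j) = 0 := by
    rw [sum_range_sub]
    simp [T, htop]
  rw [prod_sub_mul_eq_sum_coeff, ← sub_eq_zero, ← sum_sub_distrib, ← hT]
  refine sum_congr rfl fun j hj ↦ ?_
  have hj' : n + 1 - j = n - j + 1 := by have := mem_range.1 hj; omega
  simp only [T, hcoeff, hj', Nat.add_sub_add_right, geom_sum_succ (n := j), pow_succ]
  ring

end Polynomial

namespace Matrix

theorem det_projVandermonde_one_updateCol_zero {R : Type*} [CommRing R] {n : ℕ}
    (x g : Fin (n + 1) → R) :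
    ((projVandermonde 1 x).updateCol 0 g).det =
      ∑ p : Fin (n + 1), (-1) ^ (p : ℕ) * g p *
        (projVandermonde 1 fun k ↦ x (p.succAbove k)).det := by
  rw [det_succ_column_zero]
  refine sum_congr rfl fun p _ ↦ ?_
  have hminor : ((projVandermonde 1 x).updateCol 0 g).submatrix p.succAbove Fin.succ =
      projVandermonde 1 fun k ↦ x (p.succAbove k) := by
    ext i j
    simp [projVandermonde_apply]
  rw [hminor, updateCol_self]

theorem sum_prod_sub_mul_det_projVandermonde {R : Type*} [CommRing R] {n : ℕ} (q : R)
    (x : Fin (n + 1) → R) :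
    ∑ p : Fin (n + 1), (-1) ^ (p : ℕ) * (∏ k, (x p - q * x (p.succAbove k))) *
        (projVandermonde 1 fun k ↦ x (p.succAbove k)).det =
      (∑ i ∈ range (n + 1), q ^ i) * (projVandermonde 1 x).det := by
  nontriviality R
  let c (j : ℕ) : R := (∑ i ∈ range (j + 1), q ^ i) * q ^ (n - j) *
    (∏ k, (Polynomial.X - Polynomial.C (x k))).coeff (j + 1)
  have hc : c n = ∑ i ∈ range (n + 1), q ^ i := by
    have h := (Polynomial.monic_prod_X_sub_C x univ).coeff_natDegree
    rw [Polynomial.natDegree_finsetProd_X_sub_C_eq_card, card_univ, Fintype.card_fin] at h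
    simp [c, h]
  have hg : (fun p ↦ ∏ k, (x p - q * x (p.succAbove k))) =
      fun p ↦ ∑ i : Fin (n + 1), c i.rev • projVandermonde 1 x p i := by
    ext p
    rw [Polynomial.prod_sub_mul_succAbove_eq_sum_coeff, ← Fin.sum_univ_eq_sum_range
      (fun j ↦ c j * x p ^ j), ← Equiv.sum_comp Fin.revPerm]
    simp only [projVandermonde_apply, Fin.revPerm_apply, Pi.one_apply, one_pow, one_mul,
      smul_eq_mul]
  rw [← det_projVandermonde_one_updateCol_zero, hg,
    det_updateCol_sum _ _ (fun i : Fin (n + 1) ↦ c i.rev)]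
  simp [hc]

end Matrix

theorem sum_perm_sign_mul_prod_sub_mul {R : Type*} [CommRing R] (q : R) (s : ℕ) (x : Fin s → R) :
    ∑ σ : Equiv.Perm (Fin s), ((Equiv.Perm.sign σ : ℤ) : R) *
        ∏ j : Fin s, ∏ k ∈ Ioi j, (x (σ j) - q * x (σ k)) =
      (∏ j : Fin s, ∑ i ∈ range (j.val + 1), q ^ i) * (Matrix.projVandermonde 1 x).det := by
  induction s with
  | zero => simp
  | succ n ih =>
    simp only [Fin.prod_univ_succ (fun j ↦ ∏ k ∈ Ioi j, _), Fin.prod_Ioi_zero, Fin.prod_Ioi_succ]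
    rw [Fin.sum_perm_succ_sign_mul fun p f ↦ (∏ k, (x p - q * x (f k))) *
      ∏ j, ∏ k ∈ Ioi j, (x (f j) - q * x (f k)), Fin.prod_univ_castSucc, mul_assoc]
    simp only [Fin.val_last, Fin.val_castSucc]
    rw [← Matrix.sum_prod_sub_mul_det_projVandermonde, mul_sum]
    refine sum_congr rfl fun p _ ↦ ?_
    have hprod (τ : Equiv.Perm (Fin n)) : ∏ k, (x p - q * x (p.succAbove (τ k))) =
        ∏ k, (x p - q * x (p.succAbove k)) :=
      Equiv.prod_comp τ fun k ↦ x p - q * x (p.succAbove k)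
    simp only [hprod, mul_left_comm _ (∏ k, (x p - q * x (p.succAbove k))), ← mul_sum]
    rw [ih fun k ↦ x (p.succAbove k)]
    ring

/-- Antisymmetrization identity (Lemma 3 of Cantini–Colomo–Pronko):
`Asym_{ε₁,…,ε_s} ∏_{j<k} (ε_j − t² ε_k) = ∏_{j=1}^s (1 + t² + ⋯ + t^{2(j−1)}) · ∏_{j<k} (ε_j − ε_k)`. -/
theorem stmt0 (R : Type*) [CommRing R] (t : R) (s : ℕ) (hs : 1 ≤ s) (ε : Fin s → R) :
    ∑ σ : Equiv.Perm (Fin s), ((Equiv.Perm.sign σ : ℤ) : R) *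
        ∏ j : Fin s, ∏ k ∈ Ioi j, (ε (σ j) - t ^ 2 * ε (σ k)) =
      (∏ j : Fin s, ∑ i ∈ range (j.val + 1), t ^ (2 * i)) *
        ∏ j : Fin s, ∏ k ∈ Ioi j, (ε j - ε k) := by
  simpa [Matrix.det_projVandermonde, pow_mul] using sum_perm_sign_mul_prod_sub_mul (t ^ 2) s ε
end

section
/- Fix an integer s ≥ 1 and parameters p, q with p + q = 1 (as elements of a field of characteristic 0, or as rational functions). Then for indeterminates z₁,…,z_s the following identity of rational functions holds: ∑_{σ ∈ S_s} sgn(σ) ∏_{j=1}^{s} ( z_{σ(j)}^{s−j} / (1 − ∏_{l=1}^{j} z_{σ(l)}) ) · ∏_{1≤j<k≤s} (q·z_{σ(j)}z_{σ(k)} − z_{σ(k)} + p) = p^{s(s−1)/2} · ∏_{j=1}^{s} 1/(1 − z_j) · ∏_{1≤j<k≤s} (z_j − z_k). -/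
open Finset

open Polynomial in
/-- Lagrange interpolation of `∏ y ∈ T, (q y X - X + p)` at the nodes `T`, `0` and `r = p / q`. -/
theorem sum_prod_mul_div_sub_of_generic {K : Type*} [Field K] [DecidableEq K] {p q r : K}
    (hpq : p + q = 1) (hq : q ≠ 0) (hr : r ≠ 0) (hp : p = q * r)
    {T : Finset K} (hT : T.Nonempty) (h0 : 0 ∉ T) (hrT : r ∉ T) :
    ∑ x ∈ T, (1 - x) * ∏ y ∈ T.erase x, (y * (q * x * y - x + p) / (y - x)) =
      p ^ (#T - 1) * (1 - ∏ y ∈ T, y) := by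
  obtain ⟨n, hn⟩ : ∃ n, #T = n + 1 := ⟨#T - 1, by have := hT.card_pos; omega⟩
  have hP : ∏ y ∈ T, y ≠ 0 := prod_ne_zero_iff.2 fun y hy h => h0 (h ▸ hy)
  have hS0 : (0 : K) ∉ insert r T := by simp [h0, hr.symm]
  have hcard : #(insert 0 (insert r T)) = n + 3 := by
    rw [card_insert_of_notMem hS0, card_insert_of_notMem hrT, hn]
  let g : K[X] := ∏ y ∈ T, (C (q * y - 1) * X + C p)
  have hg (x : K) : g.eval x = ∏ y ∈ T, (q * x * y - x + p) := by
    simp only [g, eval_prod, eval_add, eval_mul, eval_C, eval_X]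
    exact prod_congr rfl fun y _ => by ring
  have hdeg : g.natDegree ≤ n + 1 := by
    refine (natDegree_prod_le _ _).trans ?_
    refine (sum_le_card_nsmul _ _ 1 fun y _ => natDegree_linear_le).trans ?_
    simp [hn]
  have key := Lagrange.coeff_eq_sum (s := insert 0 (insert r T)) (v := id) (P := g)
    (Set.injOn_id _) (by
      rw [hcard]
      exact (degree_le_of_natDegree_le hdeg).trans_lt (by norm_cast; omega))
  rw [coeff_eq_zero_of_natDegree_lt (by omega), sum_insert hS0, sum_insert hrT,
    erase_insert hS0, erase_insert_of_ne hr.symm, erase_insert hrT,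
    prod_insert hrT, prod_insert h0] at key
  simp only [id, hg] at key
  have e0 : ∏ y ∈ T, (q * 0 * y - 0 + p) = p ^ (n + 1) := by simp [hn]
  have e1 : ∏ y ∈ T, (0 - y) = (-1) ^ (n + 1) * ∏ y ∈ T, y := by
    rw [← hn, ← prod_const, ← prod_mul_distrib]
    exact prod_congr rfl fun y _ => by ring
  have e2 : ∏ y ∈ T, (q * r * y - r + p) = p ^ (n + 1) * (-1) ^ (n + 1) * ∏ y ∈ T, (r - y) := by
    rw [← hn, ← prod_const, ← prod_const, ← prod_mul_distrib, ← prod_mul_distrib]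
    refine prod_congr rfl fun y _ => ?_
    linear_combination (1 - y) * hp + r * hpq
  have e3 : ∏ y ∈ T, (r - y) ≠ 0 :=
    prod_ne_zero_iff.2 fun y hy h => hrT (sub_eq_zero.1 h ▸ hy)
  have e4 : ∀ x ∈ T, (∏ y ∈ T, (q * x * y - x + p)) /
      ∏ y ∈ (insert 0 (insert r T)).erase x, (x - y) =
      (q * (-1) ^ (n + 1) / ∏ y ∈ T, y) *
        ((1 - x) * ∏ y ∈ T.erase x, (y * (q * x * y - x + p) / (y - x))) := by
    intro x hx
    have hx0 : x ≠ 0 := fun h => h0 (h ▸ hx)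
    have hxr : x ≠ r := fun h => hrT (h ▸ hx)
    have hxr' : x - r ≠ 0 := sub_ne_zero.2 hxr
    rw [erase_insert_of_ne hx0.symm, erase_insert_of_ne hxr.symm,
      prod_insert (by simp [h0, hr.symm]), prod_insert (by simp [hrT]),
      ← mul_prod_erase T _ hx, ← mul_prod_erase T (fun y => y) hx, prod_div_distrib,
      prod_mul_distrib]
    have hsub : ∏ y ∈ T.erase x, (x - y) = (-1) ^ n * ∏ y ∈ T.erase x, (y - x) := by
      have : #(T.erase x) = n := by rw [card_erase_of_mem hx, hn]; rfl
      rw [← this, ← prod_const, ← prod_mul_distrib]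
      exact prod_congr rfl fun y _ => by ring
    have hne : ∏ y ∈ T.erase x, (y - x) ≠ 0 :=
      prod_ne_zero_iff.2 fun y hy => sub_ne_zero.2 (ne_of_mem_erase hy)
    have hne' : ∏ y ∈ T.erase x, y ≠ 0 :=
      prod_ne_zero_iff.2 fun y hy h => h0 (h ▸ mem_of_mem_erase hy)
    have hfac : q * x * x - x + p = -((1 - x) * q * (x - r)) := by
      linear_combination (1 - x) * hp + x * hpq
    have hsq : ((-1 : K) ^ n) ^ 2 = 1 := by rw [← pow_mul, mul_comm, pow_mul]; simp
    have hs0 : (-1 : K) ^ n ≠ 0 := by simp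
    rw [hsub, hfac]
    simp only [sub_zero]
    generalize ∏ y ∈ T.erase x, (q * x * y - x + p) = G
    field_simp
    rw [pow_succ]
    linear_combination ((1 - x) * G) * hsq
  have hs0 : (-1 : K) ^ (n + 1) ≠ 0 := by simp
  have hsq : ((-1 : K) ^ (n + 1)) ^ 2 = 1 := by rw [← pow_mul, mul_comm, pow_mul]; simp
  rw [sum_congr rfl e4, ← mul_sum, e0, e1, e2, zero_sub, sub_zero] at key
  rw [hn, Nat.add_sub_cancel]
  generalize ∑ x ∈ T, (1 - x) * ∏ y ∈ T.erase x, (y * (q * x * y - x + p) / (y - x)) = A at *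
  generalize ∏ y ∈ T, y = P at *
  generalize ∏ y ∈ T, (r - y) = R at *
  generalize (-1 : K) ^ (n + 1) = ε at *
  have hp0 : p ≠ 0 := hp ▸ mul_ne_zero hq hr
  field_simp at key
  apply mul_left_cancel₀ hp0
  linear_combination A * hp - key - (p ^ (n + 1) * P + q * r * A) * hsq

/-- The product over the indices other than `m`, enumerated by `swap 0 m ∘ Fin.succ`. -/
theorem prod_swap_zero_succ {M : Type*} [CommMonoid M] {n : ℕ} (m : Fin (n + 1))
    (f : Fin (n + 1) → M) :
    ∏ i : Fin n, f (Equiv.swap 0 m i.succ) = ∏ j ∈ univ.erase m, f j := by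
  rw [← Fin.prod_Ioi_zero fun j => f (Equiv.swap 0 m j)]
  refine prod_equiv (Equiv.swap 0 m) (fun j => ?_) fun _ _ => rfl
  simp [Equiv.swap_apply_eq_iff]

theorem det_vandermonde_comp_perm {R : Type*} [CommRing R] {n : ℕ} (σ : Equiv.Perm (Fin n))
    (z : Fin n → R) :
    (Matrix.vandermonde (z ∘ σ)).det = (Equiv.Perm.sign σ : ℤ) * (Matrix.vandermonde z).det :=
  Matrix.det_permute σ (Matrix.vandermonde z)

theorem sign_mul_det_vandermonde_swap_zero_succ {R : Type*} [CommRing R] {n : ℕ}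
    (m : Fin (n + 1)) (z : Fin (n + 1) → R) :
    (∏ j ∈ univ.erase m, (z j - z m)) * ((Equiv.Perm.sign (Equiv.swap 0 m) : ℤ) *
      (Matrix.vandermonde fun i : Fin n => z (Equiv.swap 0 m i.succ)).det) =
      (Matrix.vandermonde z).det := by
  have h := det_vandermonde_comp_perm (Equiv.swap 0 m) z
  rw [Matrix.det_vandermonde, Fin.prod_univ_succ, Fin.prod_Ioi_zero] at h
  simp only [Fin.prod_Ioi_succ, Function.comp_apply, Equiv.swap_apply_left] at h
  rw [← Matrix.det_vandermonde fun i : Fin n => z (Equiv.swap 0 m i.succ),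
    prod_swap_zero_succ m fun j => z j - z m] at h
  have hs : ((Equiv.Perm.sign (Equiv.swap 0 m) : ℤ) : R) ^ 2 = 1 := by
    rw [← Int.cast_pow, ← Units.val_pow_eq_pow_val, Int.units_sq]; simp
  linear_combination ((Equiv.Perm.sign (Equiv.swap 0 m) : ℤ) : R) * h +
    (Matrix.vandermonde z).det * hs

theorem sum_sign_mul_det_vandermonde_of_generic {K : Type*} [Field K] {p q : K} (hpq : p + q = 1)
    (hp : p ≠ 0) (hq : q ≠ 0) {n : ℕ} {z : Fin (n + 1) → K} (hz : Function.Injective z)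
    (h0 : ∀ j, z j ≠ 0) (hr : ∀ j, p - q * z j ≠ 0) :
    ∑ m, (Equiv.Perm.sign (Equiv.swap 0 m) : ℤ) * ((1 - z m) *
        (∏ j ∈ univ.erase m, (z j * (q * z m * z j - z m + p))) *
        (Matrix.vandermonde fun i : Fin n => z (Equiv.swap 0 m i.succ)).det) =
      p ^ n * (1 - ∏ j, z j) * (Matrix.vandermonde z).det := by
  classical
  have key := sum_prod_mul_div_sub_of_generic (T := univ.map ⟨z, hz⟩) (r := p / q) hpq hq
    (div_ne_zero hp hq) (by field_simp) (by simp) (by simpa using h0) (by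
      simp only [mem_map, mem_univ, true_and, Function.Embedding.coeFn_mk, not_exists]
      intro j hj
      apply hr j
      rw [hj]
      field_simp
      simp)
  rw [sum_map, prod_map, card_map, card_univ, Fintype.card_fin, Nat.add_sub_cancel] at key
  have herase (m) : (univ.map ⟨z, hz⟩).erase (z m) = (univ.erase m).map ⟨z, hz⟩ :=
    (map_erase _ _ _).symm
  simp only [Function.Embedding.coeFn_mk, herase, prod_map] at key
  rw [← key, sum_mul]
  refine sum_congr rfl fun m _ => ?_
  have hne : ∏ j ∈ univ.erase m, (z j - z m) ≠ 0 :=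
    prod_ne_zero_iff.2 fun j hj => sub_ne_zero.2 (hz.ne (ne_of_mem_erase hj))
  rw [← sign_mul_det_vandermonde_swap_zero_succ m z, prod_div_distrib]
  generalize ∏ j ∈ univ.erase m, (z j * (q * z m * z j - z m + p)) = G
  field_simp

open MvPolynomial in
theorem sum_sign_mul_det_vandermonde {R : Type*} [CommRing R] {p q : R} (hpq : p + q = 1)
    {n : ℕ} (z : Fin (n + 1) → R) :
    ∑ m, (Equiv.Perm.sign (Equiv.swap 0 m) : ℤ) * ((1 - z m) *
        (∏ j ∈ univ.erase m, (z j * (q * z m * z j - z m + p))) *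
        (Matrix.vandermonde fun i : Fin n => z (Equiv.swap 0 m i.succ)).det) =
      p ^ n * (1 - ∏ j, z j) * (Matrix.vandermonde z).det := by
  let A := MvPolynomial (Option (Fin (n + 1))) ℤ
  let P : A := X none
  let Z : Fin (n + 1) → A := fun j => X (some j)
  have generic : ∑ m, (Equiv.Perm.sign (Equiv.swap 0 m) : ℤ) * ((1 - Z m) *
        (∏ j ∈ univ.erase m, (Z j * ((1 - P) * Z m * Z j - Z m + P))) *
        (Matrix.vandermonde fun i : Fin n => Z (Equiv.swap 0 m i.succ)).det) =
      P ^ n * (1 - ∏ j, Z j) * (Matrix.vandermonde Z).det := by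
    have hinj := IsFractionRing.injective A (FractionRing A)
    apply hinj
    have hZ : Function.Injective Z := (X_injective).comp (Option.some_injective _)
    have hne {f : A} (x : ℤ) (hf : aeval (fun i : Option (Fin (n + 1)) => i.elim x fun _ => 0) f
        ≠ (0 : ℤ)) : algebraMap A (FractionRing A) f ≠ 0 :=
      fun h => hf (by rw [hinj (h.trans (map_zero _).symm), map_zero])
    have := sum_sign_mul_det_vandermonde_of_generic (K := FractionRing A) (n := n)
      (p := algebraMap A _ P) (q := algebraMap A _ (1 - P)) (z := fun j => algebraMap A _ (Z j))
      (by rw [← map_add]; simp) (hne 1 (by simp [P])) (hne 0 (by simp [P])) (hinj.comp hZ)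
      (fun j => (map_ne_zero_iff _ hinj).2 (X_ne_zero _)) (fun j => by
        rw [← map_mul, ← map_sub]
        exact hne 1 (by simp [P]))
    simp only [Matrix.det_vandermonde] at this ⊢
    simpa only [map_sum, map_mul, map_prod, map_sub, map_add, map_one, map_pow, map_intCast]
      using this
  have h := congrArg (aeval (fun i : Option (Fin (n + 1)) => i.elim p z)) generic
  obtain rfl : q = 1 - p := by linear_combination hpq
  simp only [Matrix.det_vandermonde] at h ⊢
  simpa [P, Z] using h

theorem sum_sign_mul_prod_eq_det_vandermonde {F : Type*} [Field F] {p q : F} (hpq : p + q = 1)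
    {n : ℕ} (z : Fin n → F) (hz : ∀ T : Finset (Fin n), T.Nonempty → 1 - ∏ l ∈ T, z l ≠ 0) :
    ∑ σ : Equiv.Perm (Fin n), ((Equiv.Perm.sign σ : ℤ) : F) *
        ((∏ j, z (σ j) ^ j.val / (1 - ∏ l ∈ Ici j, z (σ l))) *
          ∏ j, ∏ k ∈ Ioi j, (q * z (σ j) * z (σ k) - z (σ j) + p)) =
      p ^ (n * (n - 1) / 2) * (∏ j, (1 - z j)⁻¹) * (Matrix.vandermonde z).det := by
  induction n with
  | zero => simp
  | succ n ih =>
    have hP : 1 - ∏ j, z j ≠ 0 := hz univ univ_nonempty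
    have key := sum_sign_mul_det_vandermonde hpq z
    rw [← Equiv.Perm.decomposeFin.symm.sum_comp, Fintype.sum_prod_type]
    have step (m : Fin (n + 1)) : ∑ e : Equiv.Perm (Fin n),
        ((Equiv.Perm.sign (Equiv.Perm.decomposeFin.symm (m, e)) : ℤ) : F) *
          ((∏ j, z (Equiv.Perm.decomposeFin.symm (m, e) j) ^ j.val /
            (1 - ∏ l ∈ Ici j, z (Equiv.Perm.decomposeFin.symm (m, e) l))) *
          ∏ j, ∏ k ∈ Ioi j, (q * z (Equiv.Perm.decomposeFin.symm (m, e) j) *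
            z (Equiv.Perm.decomposeFin.symm (m, e) k) -
            z (Equiv.Perm.decomposeFin.symm (m, e) j) + p)) =
        (1 - ∏ j, z j)⁻¹ * p ^ (n * (n - 1) / 2) * (∏ j, (1 - z j)⁻¹) *
          ((Equiv.Perm.sign (Equiv.swap 0 m) : ℤ) * ((1 - z m) *
          (∏ j ∈ univ.erase m, (z j * (q * z m * z j - z m + p))) *
          (Matrix.vandermonde fun i : Fin n => z (Equiv.swap 0 m i.succ)).det)) := by
      let w : Fin n → F := fun i => z (Equiv.swap 0 m i.succ)
      have hw (T : Finset (Fin n)) (hT : T.Nonempty) : 1 - ∏ l ∈ T, w l ≠ 0 := by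
        have := hz (T.map ((Fin.succEmb n).trans (Equiv.swap 0 m).toEmbedding))
          hT.map
        simpa [prod_map] using this
      have hm : 1 - z m ≠ 0 := by simpa using hz {m} (singleton_nonempty m)
      have hinv : ∏ j, (1 - w j)⁻¹ = (1 - z m) * ∏ j, (1 - z j)⁻¹ := by
        rw [prod_swap_zero_succ m fun j => (1 - z j)⁻¹, ← mul_prod_erase univ _ (mem_univ m),
          mul_inv_cancel_left₀ hm]
      have hsign (e : Equiv.Perm (Fin n)) :
          Equiv.Perm.sign (Equiv.Perm.decomposeFin.symm (m, e)) =
          Equiv.Perm.sign (Equiv.swap 0 m) * Equiv.Perm.sign e := by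
        simp [Equiv.Perm.sign_swap', eq_comm]
      have hterm (e : Equiv.Perm (Fin n)) :
          ((Equiv.Perm.sign (Equiv.Perm.decomposeFin.symm (m, e)) : ℤ) : F) *
          ((∏ j, z (Equiv.Perm.decomposeFin.symm (m, e) j) ^ j.val /
            (1 - ∏ l ∈ Ici j, z (Equiv.Perm.decomposeFin.symm (m, e) l))) *
          ∏ j, ∏ k ∈ Ioi j, (q * z (Equiv.Perm.decomposeFin.symm (m, e) j) *
            z (Equiv.Perm.decomposeFin.symm (m, e) k) -
            z (Equiv.Perm.decomposeFin.symm (m, e) j) + p)) =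
          (1 - ∏ j, z j)⁻¹ * (Equiv.Perm.sign (Equiv.swap 0 m) : ℤ) *
          (∏ i, (w i * (q * z m * w i - z m + p))) *
          (((Equiv.Perm.sign e : ℤ) : F) *
            ((∏ j, w (e j) ^ j.val / (1 - ∏ l ∈ Ici j, w (e l))) *
              ∏ j, ∏ k ∈ Ioi j, (q * w (e j) * w (e k) - w (e j) + p))) := by
        rw [hsign, ← Equiv.prod_comp e fun i => w i * (q * z m * w i - z m + p),
          Fin.prod_univ_succ, Fin.prod_univ_succ, Fin.prod_Ioi_zero]
        have hI : Ici (0 : Fin (n + 1)) = univ := by ext; simp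
        rw [hI, Equiv.prod_comp (Equiv.Perm.decomposeFin.symm (m, e)) z]
        simp only [Fin.prod_Ici_succ, Fin.prod_Ioi_succ, Equiv.Perm.decomposeFin_symm_apply_zero,
          Equiv.Perm.decomposeFin_symm_apply_succ, Fin.val_zero, Fin.val_succ, pow_zero, pow_succ,
          prod_mul_distrib, prod_div_distrib, Units.val_mul, Int.cast_mul, w]
        ring
      rw [sum_congr rfl fun e _ => hterm e, ← mul_sum, ih w hw, hinv,
        prod_swap_zero_succ m fun j => z j * (q * z m * z j - z m + p)]
      ring
    rw [sum_congr rfl fun m _ => step m, ← mul_sum, key, Nat.triangle_succ, pow_add]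
    field_simp

theorem prod_prod_Ioi_rev {M : Type*} [CommMonoid M] {n : ℕ} (f : Fin n → Fin n → M) :
    ∏ j : Fin n, ∏ k ∈ Ioi j, f j.rev k.rev = ∏ j, ∏ k ∈ Ioi j, f k j := by
  have h (j : Fin n) : ∏ k ∈ Ioi j, f j.rev k.rev = ∏ k ∈ Iio j.rev, f j.rev k := by
    rw [← Fin.map_revPerm_Ioi, prod_map]
    rfl
  rw [prod_congr rfl fun j _ => h j]
  refine (Equiv.prod_comp Fin.revPerm fun j => ∏ k ∈ Iio j, f j k).trans ?_
  exact prod_comm' (by simp)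

/-- Tracy–Widom antisymmetrization identity: for `p + q = 1`,
`Asym[∏_j z_j^{s-j}/(1-∏_{l≤j}z_l) · ∏_{j<k}(q z_j z_k - z_k + p)]
  = p^{s(s-1)/2} ∏_j (1-z_j)⁻¹ ∏_{j<k}(z_j - z_k)`. -/
theorem stmt5 (s : ℕ) (hs : 1 ≤ s) (F : Type*) [Field F] [CharZero F]
    (p q : F) (hpq : p + q = 1) (z : Fin s → F)
    (hz : ∀ T : Finset (Fin s), T.Nonempty → 1 - ∏ l ∈ T, z l ≠ 0) :
    ∑ σ : Equiv.Perm (Fin s), ((Equiv.Perm.sign σ : ℤ) : F) *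
        ((∏ j : Fin s, z (σ j) ^ (s - (j.val + 1)) / (1 - ∏ l ∈ Iic j, z (σ l))) *
          ∏ j : Fin s, ∏ k ∈ Ioi j, (q * z (σ j) * z (σ k) - z (σ k) + p)) =
      p ^ (s * (s - 1) / 2) * (∏ j : Fin s, (1 - z j)⁻¹) *
        ∏ j : Fin s, ∏ k ∈ Ioi j, (z j - z k) := by
  have key := sum_sign_mul_prod_eq_det_vandermonde hpq (z ∘ Fin.rev) fun T hT => by
    simpa [prod_map] using hz (T.map Fin.revPerm.toEmbedding) hT.map
  rw [Matrix.det_vandermonde] at key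
  simp only [Function.comp_apply] at key
  have hrev : ∏ j, (1 - z (Fin.rev j))⁻¹ = ∏ j, (1 - z j)⁻¹ :=
    Equiv.prod_comp Fin.revPerm fun j => (1 - z j)⁻¹
  rw [hrev, prod_prod_Ioi_rev fun j k => z k - z j, ← (Fin.revPerm.permCongr).sum_comp] at key
  rw [← key]
  refine sum_congr rfl fun σ _ => ?_
  rw [Equiv.Perm.sign_permCongr]
  congr 2
  · rw [← Equiv.prod_comp Fin.revPerm]
    refine prod_congr rfl fun j _ => ?_
    simp only [Equiv.permCongr_apply, Fin.revPerm_apply, Fin.revPerm_symm, Fin.rev_rev,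
      Fin.val_rev]
    rw [← Fin.map_revPerm_Ici, prod_map]
    congr 2
    omega
  · simp only [Equiv.permCongr_apply, Fin.revPerm_apply, Fin.revPerm_symm, Fin.rev_rev]
    rw [prod_prod_Ioi_rev fun j k => q * z (σ j) * z (σ k) - z (σ j) + p]
    exact prod_congr rfl fun j _ => prod_congr rfl fun k _ => by ring
end

section
/- Let s ≥ 1 and let τ, x₁,…,x_s, y₁,…,y_s be indeterminates. Define ψ(x,y) = 1/((1 − xy)(x + y + τxy)). Then in the field ℚ(τ, x₁,…,x_s, y₁,…,y_s): ∑_{σ,ρ ∈ S_s} sgn(σ)sgn(ρ) ∏_{j=1}^{s} ( (x_{σ(j)} y_{ρ(j)})^{s−j} / (1 − ∏_{l=1}^{j} x_{σ(l)} y_{ρ(l)}) ) · ∏_{1≤j<k≤s} (x_{σ(j)}x_{σ(k)} + τ x_{σ(k)} + 1)(y_{ρ(j)}y_{ρ(k)} + τ y_{ρ(k)} + 1) = ∏_{j,k=1}^{s} (x_j + y_k + τ x_j y_k) · det_{1≤j,k≤s} [ψ(x_j, y_k)]. -/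
open Finset

/-- Polynomial functions on the plane that are homogeneous of a given degree. -/
inductive IsForm {F : Type*} [Field F] : ℕ → (F × F → F) → Prop
  | const (c : F) (h : F × F → F) (hh : ∀ v, h v = c) : IsForm 0 h
  | step {d : ℕ} {g₁ g₂ : F × F → F} (hg₁ : IsForm d g₁) (hg₂ : IsForm d g₂) (h : F × F → F)
      (hh : ∀ v, h v = v.1 * g₁ v + v.2 * g₂ v) : IsForm (d + 1) h

namespace IsForm

variable {F : Type*} [Field F]

theorem add {d : ℕ} {f g : F × F → F} (hf : IsForm d f) (hg : IsForm d g) :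
    IsForm d (fun v => f v + g v) := by
  induction hf generalizing g with
  | const c f hf =>
    cases hg with
    | const c' _ hg => exact const (c + c') _ fun v => by rw [hf, hg]
  | step _ _ f hf ih₁ ih₂ =>
    cases hg with
    | step hg₁ hg₂ _ hg => exact step (ih₁ hg₁) (ih₂ hg₂) _ fun v => by rw [hf, hg]; ring

theorem const_mul {d : ℕ} {f : F × F → F} (c : F) (hf : IsForm d f) :
    IsForm d (fun v => c * f v) := by
  induction hf with
  | const c' f hf => exact const (c * c') _ fun v => by rw [hf]
  | step _ _ f hf ih₁ ih₂ => exact step ih₁ ih₂ _ fun v => by rw [hf]; ring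

theorem mul {d e : ℕ} {f g : F × F → F} (hf : IsForm d f) (hg : IsForm e g) :
    IsForm (d + e) (fun v => f v * g v) := by
  induction hf with
  | const c f hf =>
    simpa only [hf, zero_add] using hg.const_mul c
  | step _ _ f hf ih₁ ih₂ =>
    rw [Nat.add_right_comm]
    exact step ih₁ ih₂ _ fun v => by rw [hf]; ring

theorem linear (c₁ c₂ : F) : IsForm 1 (fun v : F × F => c₁ * v.1 + c₂ * v.2) :=
  step (const c₁ _ fun _ => rfl) (const c₂ _ fun _ => rfl) _ fun v => by ring

theorem prod_linear {ι : Type*} [DecidableEq ι] (S : Finset ι) (f : ι → F × F → F)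
    (hf : ∀ i ∈ S, IsForm 1 (f i)) : IsForm S.card (fun v => ∏ i ∈ S, f i v) := by
  induction S using Finset.induction_on with
  | empty => exact const 1 _ fun v => by simp
  | insert a S ha ih =>
    rw [card_insert_of_notMem ha, add_comm]
    simp only [prod_insert ha]
    exact (hf a (mem_insert_self _ _)).mul (ih fun i hi => hf i (mem_insert_of_mem hi))

end IsForm

/-- The determinant of two vectors of the plane. -/
def bracket {F : Type*} [Field F] (v w : F × F) : F := v.1 * w.2 - v.2 * w.1

/-- Homogeneous Lagrange interpolation on the projective line. -/
theorem IsForm.interpolation {F : Type*} [Field F] {ι : Type*} [DecidableEq ι] {d : ℕ}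
    {h : F × F → F} (hh : IsForm d h) (S : Finset ι) (hS : S.card = d + 1) (P : ι → F × F)
    (hP : ∀ i ∈ S, ∀ j ∈ S, i ≠ j → bracket (P i) (P j) ≠ 0) (v : F × F) :
    h v = ∑ i ∈ S, h (P i) * ∏ k ∈ S.erase i, bracket v (P k) / bracket (P i) (P k) := by
  induction hh generalizing S with
  | const c h hh =>
    obtain ⟨a, rfl⟩ := card_eq_one.mp hS
    simp [hh]
  | @step d g₁ g₂ hg₁ hg₂ h hh ih₁ ih₂ =>
    obtain ⟨a, ha, b, hb, hab⟩ := one_lt_card.mp (show 1 < S.card by omega)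
    have key : ∀ g : F × F → F, (∀ T : Finset ι, T.card = d + 1 →
        (∀ i ∈ T, ∀ j ∈ T, i ≠ j → bracket (P i) (P j) ≠ 0) →
        g v = ∑ i ∈ T, g (P i) * ∏ k ∈ T.erase i, bracket v (P k) / bracket (P i) (P k)) →
        ∀ a ∈ S, bracket v (P a) * g v = ∑ i ∈ S, bracket (P i) (P a) * g (P i) *
          ∏ k ∈ S.erase i, bracket v (P k) / bracket (P i) (P k) := by
      intro g hg a ha
      rw [hg (S.erase a) (by rw [card_erase_of_mem ha]; omega)
        fun i hi j hj => hP i (mem_of_mem_erase hi) j (mem_of_mem_erase hj),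
        ← add_sum_erase S _ ha]
      have h0 : bracket (P a) (P a) = 0 := by simp only [bracket]; ring
      rw [h0, zero_mul, zero_mul, zero_add, mul_sum]
      refine sum_congr rfl fun i hi => ?_
      have hia : a ∈ S.erase i := mem_erase.mpr ⟨(ne_of_mem_erase hi).symm, ha⟩
      have hne := hP i (mem_of_mem_erase hi) a ha (ne_of_mem_erase hi)
      rw [← mul_prod_erase (S.erase i) _ hia, erase_right_comm]
      field_simp
    have hne := hP a ha b hb hab
    have e : ∀ u : F × F, h u = (bracket (P a) (P b))⁻¹ *
        ((P a).1 * (bracket u (P b) * g₁ u) + (P a).2 * (bracket u (P b) * g₂ u)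
        - (P b).1 * (bracket u (P a) * g₁ u) - (P b).2 * (bracket u (P a) * g₂ u)) := by
      intro u
      rw [hh, eq_inv_mul_iff_mul_eq₀ hne]
      simp only [bracket]
      ring
    rw [e v, key g₁ ih₁ a ha, key g₂ ih₂ a ha, key g₁ ih₁ b hb, key g₂ ih₂ b hb]
    simp only [mul_sum, ← sum_add_distrib, ← sum_sub_distrib]
    refine sum_congr rfl fun i _ => ?_
    rw [e (P i)]
    ring

/-- The quotient of `∏ (A q + B) - ∏ B` by `q`, together with its values at the zeros of the
factors `B`. -/
theorem IsForm.exists_quotient {F : Type*} [Field F] {ι : Type*} [DecidableEq ι]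
    (S : Finset ι) (hS : S.Nonempty) (A : ι → F) (q : F × F → F) (B : ι → F × F → F)
    (hq : IsForm 2 q) (hB : ∀ i ∈ S, IsForm 2 (B i)) :
    ∃ K : F × F → F, IsForm (2 * S.card - 2) K ∧
      (∀ v, q v * K v + ∏ i ∈ S, B i v = ∏ i ∈ S, (A i * q v + B i v)) ∧
      ∀ v, ∀ b ∈ S, B b v = 0 → K v = A b * ∏ i ∈ S.erase b, (A i * q v + B i v) := by
  induction hS using Finset.Nonempty.cons_induction with
  | singleton a =>
    refine ⟨fun _ => A a, by simpa using IsForm.const (A a) _ fun _ => rfl, ?_, ?_⟩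
    · intro v; simp [mul_comm]
    · intro v b hb; simp [mem_singleton.mp hb]
  | cons a S ha hS ih =>
    obtain ⟨K, hK, hK₁, hK₂⟩ := ih fun i hi => hB i (mem_cons_of_mem hi)
    have hcard : 1 ≤ S.card := hS.card_pos
    have hqK : ∀ T : Finset ι, (∀ i ∈ T, IsForm 2 (B i)) →
        IsForm (2 * T.card) (fun v => ∏ i ∈ T, (A i * q v + B i v)) := by
      intro T hT
      induction T using Finset.induction_on with
      | empty => exact IsForm.const 1 _ fun v => by simp
      | insert c T hc ih =>
        simp only [prod_insert hc]
        rw [card_insert_of_notMem hc, mul_add, mul_one, add_comm]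
        exact ((hq.const_mul _).add (hT c (mem_insert_self _ _))).mul
          (ih fun i hi => hT i (mem_insert_of_mem hi))
    refine ⟨fun v => A a * ∏ i ∈ S, (A i * q v + B i v) + B a v * K v, ?_, ?_, ?_⟩
    · have e₁ : 2 * (cons a S ha).card - 2 = 2 * S.card := by rw [card_cons]; omega
      have e₂ : 2 + (2 * S.card - 2) = 2 * S.card := by omega
      rw [e₁]
      refine ((hqK S fun i hi => hB i (mem_cons_of_mem hi)).const_mul _).add ?_
      have := (hB a (mem_cons_self _ _)).mul hK
      rwa [e₂] at this
    · intro v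
      rw [prod_cons, prod_cons]
      linear_combination B a v * hK₁ v
    · intro v b hb hb0
      rw [cons_eq_insert] at hb ⊢
      beta_reduce
      rcases mem_insert.mp hb with rfl | hbS
      · rw [erase_insert ha, hb0]; ring
      · have hab : a ≠ b := fun h => ha (h ▸ hbS)
        rw [hK₂ v b hbS hb0, erase_insert_of_ne hab,
          prod_insert fun h => ha (mem_of_mem_erase h), ← mul_prod_erase S _ hbS, hb0]
        ring

theorem Finset.prod_erase_inl {ι κ M : Type*} [Fintype ι] [Fintype κ] [DecidableEq ι]
    [DecidableEq κ] [CommMonoid M] (f : ι ⊕ κ → M) (b : ι) :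
    ∏ k ∈ univ.erase (Sum.inl b), f k =
      (∏ k ∈ univ.erase b, f (Sum.inl k)) * ∏ k, f (Sum.inr k) := by
  rw [← prod_disjSum]
  congr 1
  ext (k | k) <;> simp

theorem Finset.prod_erase_inr {ι κ M : Type*} [Fintype ι] [Fintype κ] [DecidableEq ι]
    [DecidableEq κ] [CommMonoid M] (f : ι ⊕ κ → M) (b : κ) :
    ∏ k ∈ univ.erase (Sum.inr b), f k =
      (∏ k, f (Sum.inl k)) * ∏ k ∈ univ.erase b, f (Sum.inr k) := by
  rw [← prod_disjSum]
  congr 1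
  ext (k | k) <;> simp

section Cauchy

variable {F : Type*} [Field F] {ι : Type*} [Fintype ι] [DecidableEq ι]

/-- The numerators of a partial fraction expansion with poles at the inverses of `y`. -/
def residueNumerator (x y : ι → F) (b : ι) : F :=
  (∏ j, (1 - x j * y b)) / ∏ k ∈ univ.erase b, (y b - y k)

theorem sum_mul_residueNumerator (τ : F) (x y : ι → F) (hy : Function.Injective y)
    (hxy : ∀ j k, 1 - x j * y k ≠ 0) (hw : ∀ j k, x j + y k + τ * x j * y k ≠ 0) (a : ι) :
    ∑ b, ((1 - x a * y b) * (x a + y b + τ * x a * y b))⁻¹ * residueNumerator x y b =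
      (-1) ^ (univ.erase a).card * (∏ j ∈ univ.erase a, (x j * x a + τ * x a + 1)) /
        ∏ k, (x a + y k + τ * x a * y k) := by
  have hg := IsForm.prod_linear (univ.erase a) (fun j (v : F × F) => -x j * v.1 + 1 * v.2)
    fun j _ => IsForm.linear _ _
  have hbr : ∀ k, bracket (-x a, 1 + τ * x a) (y k, 1) = -(x a + y k + τ * x a * y k) := by
    intro k; simp only [bracket]; ring
  have := hg.interpolation univ (by rw [card_erase_of_mem (mem_univ a)]
                                    have := card_pos.mpr ⟨a, mem_univ a⟩
                                    omega) (fun k => (y k, 1))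
    (fun i _ j _ hij => by
      simpa only [bracket, mul_one, one_mul] using sub_ne_zero.mpr (hy.ne hij))
    (-x a, 1 + τ * x a)
  have hL : ∏ j ∈ univ.erase a, (-x j * -x a + 1 * (1 + τ * x a)) =
      ∏ j ∈ univ.erase a, (x j * x a + τ * x a + 1) :=
    prod_congr rfl fun j _ => by ring
  simp only [hbr] at this
  rw [hL] at this
  rw [this, eq_div_iff (prod_ne_zero_iff.mpr fun k _ => hw a k), sum_mul, mul_sum]
  refine sum_congr rfl fun b _ => ?_
  rw [residueNumerator, prod_div_distrib, prod_neg, card_erase_of_mem (mem_univ a),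
    card_erase_of_mem (mem_univ b), ← mul_prod_erase univ (fun j => 1 - x j * y b) (mem_univ a),
    ← mul_prod_erase univ (fun k => x a + y k + τ * x a * y k) (mem_univ b)]
  have h1 : ∏ k ∈ univ.erase b, bracket (y b, 1) (y k, 1) = ∏ k ∈ univ.erase b, (y b - y k) :=
    prod_congr rfl fun k _ => by simp [bracket]
  have h2 : ∏ k ∈ univ.erase a, (-x k * y b + 1 * 1) = ∏ k ∈ univ.erase a, (1 - x k * y b) :=
    prod_congr rfl fun k _ => by ring
  have h3 : ∏ k ∈ univ.erase b, (y b - y k) ≠ 0 := prod_ne_zero_iff.mpr fun k hk =>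
    sub_ne_zero.mpr (hy.ne (ne_of_mem_erase hk).symm)
  rw [h1, h2]
  have h4 := hxy a b
  have h5 := hw a b
  have h6 : ((-1 : F) ^ ((univ : Finset ι).card - 1)) * (-1) ^ ((univ : Finset ι).card - 1) = 1 := by
    rw [← mul_pow]; simp
  generalize (-1 : F) ^ ((univ : Finset ι).card - 1) = ε at *
  generalize ∏ k ∈ univ.erase a, (1 - x k * y b) = p
  generalize ∏ k ∈ univ.erase b, (x a + y k + τ * x a * y k) = q
  generalize ∏ k ∈ univ.erase b, (y b - y k) = r at *
  generalize x a + y b + τ * x a * y b = w at *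
  field_simp
  linear_combination (-p * q) * h6

/-- The coefficients of the recursion satisfied by the double antisymmetrization. -/
def recursionWeight (τ : F) (x y : ι → F) (a : ι) : F :=
  (∏ j ∈ univ.erase a, x j * (x j * x a + τ * x a + 1)) / ∏ k, (x a + y k + τ * x a * y k)

theorem recursionWeight_mul_self (τ : F) (x y : ι → F) (hy : Function.Injective y)
    (hxy : ∀ j k, 1 - x j * y k ≠ 0) (hw : ∀ j k, x j + y k + τ * x j * y k ≠ 0) (a : ι) :
    recursionWeight τ x y a * x a = (-1) ^ (Fintype.card ι - 1) * (∏ j, x j) *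
      ∑ b, ((1 - x a * y b) * (x a + y b + τ * x a * y b))⁻¹ * residueNumerator x y b := by
  rw [sum_mul_residueNumerator τ x y hy hxy hw, recursionWeight, prod_mul_distrib,
    ← mul_prod_erase univ x (mem_univ a), card_erase_of_mem (mem_univ a), card_univ]
  have h6 : ((-1 : F) ^ (Fintype.card ι - 1)) * (-1) ^ (Fintype.card ι - 1) = 1 := by
    rw [← mul_pow]; simp
  linear_combination (-(x a * ∏ j ∈ univ.erase a, x j) *
    (∏ j ∈ univ.erase a, (x j * x a + τ * x a + 1)) /
      ∏ k, (x a + y k + τ * x a * y k)) * h6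

theorem one_sub_prod_mul_prod [Nonempty ι] (τ : F) (x y : ι → F) (hx : Function.Injective x)
    (hy : Function.Injective y) (hw : ∀ j k, x j + y k + τ * x j * y k ≠ 0) :
    1 - (∏ j, x j) * ∏ k, y k = (-1) ^ (Fintype.card ι - 1) *
      ((∏ j, x j) * ∑ b, residueNumerator x y b * recursionWeight τ y x b +
        (∏ k, y k) * ∑ a, residueNumerator y x a * ((1 + τ * x a) * recursionWeight τ x y a)) := by
  have hq : IsForm 2 (fun v : F × F => v.2 * v.2 + τ * v.2 * v.1 + v.1 * v.1) :=
    IsForm.step (IsForm.linear 1 τ) (IsForm.linear 0 1) _ fun v => by ring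
  obtain ⟨K, hK, hK₁, hK₂⟩ := IsForm.exists_quotient (univ : Finset ι) univ_nonempty
    (fun j => 1 - x j * y j) _
    (fun j v => -(((1 + τ * x j) * v.1 + x j * v.2) * (1 * v.1 + -y j * v.2))) hq
    fun j _ => by
      simpa only [neg_one_mul] using
        ((IsForm.linear (1 + τ * x j) (x j)).mul (IsForm.linear 1 (-y j))).const_mul (-1)
  have hfac : ∀ (v : F × F) (j : ι),
      (1 - x j * y j) * (v.2 * v.2 + τ * v.2 * v.1 + v.1 * v.1) +
        -(((1 + τ * x j) * v.1 + x j * v.2) * (1 * v.1 + -y j * v.2)) =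
      (v.2 - x j * v.1) * (v.2 + τ * v.1 + y j * v.1) := by
    intro v j; ring
  simp only [hfac] at hK₁ hK₂
  have hP : ∀ i j : ι ⊕ ι, i ≠ j → bracket
      (Sum.elim (fun b => (y b, 1)) (fun a => (-x a, 1 + τ * x a)) i)
      (Sum.elim (fun b => (y b, 1)) (fun a => (-x a, 1 + τ * x a)) j) ≠ 0 := by
    rintro (i | i) (j | j) hij
    · intro h
      simp only [bracket, Sum.elim_inl] at h
      exact hij (congrArg _ (hy (by linear_combination h)))
    · intro h
      simp only [bracket, Sum.elim_inl, Sum.elim_inr] at h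
      exact hw j i (by linear_combination h)
    · intro h
      simp only [bracket, Sum.elim_inl, Sum.elim_inr] at h
      exact hw i j (by linear_combination -h)
    · intro h
      simp only [bracket, Sum.elim_inr] at h
      exact hij (congrArg _ (hx (by linear_combination -h)))
  have hcard : 1 ≤ Fintype.card ι := Fintype.card_pos
  have hinterp := ((IsForm.linear (0 : F) 1).mul hK).interpolation (univ : Finset (ι ⊕ ι))
    (by rw [card_univ, Fintype.card_sum, card_univ]; omega) _ (fun i _ j _ => hP i j) (0, 1)
  have hK0 := hK₁ (0, 1)
  have hKy : ∀ b, K (y b, 1) = (∏ j, (1 - x j * y b)) *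
      ∏ k ∈ univ.erase b, (y k * y b + τ * y b + 1) := by
    intro b
    rw [hK₂ (y b, 1) b (mem_univ b) (by simp), prod_mul_distrib,
      ← mul_prod_erase univ _ (mem_univ b), mul_assoc]
    congr 2
    exact prod_congr rfl fun k _ => by ring
  have hKx : ∀ a, K (-x a, 1 + τ * x a) = (∏ k, (1 - y k * x a)) *
      ∏ j ∈ univ.erase a, (x j * x a + τ * x a + 1) := by
    intro a
    rw [hK₂ (-x a, 1 + τ * x a) a (mem_univ a) (by simp only; ring), prod_mul_distrib,
      ← mul_prod_erase univ _ (mem_univ a), mul_comm (x a), mul_assoc]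
    congr 1
    rw [mul_comm]
    congr 1 <;> exact prod_congr rfl fun k _ => by ring
  have hprod : ∏ j, -(((1 + τ * x j) * 0 + x j * 1) * (1 * 0 + -y j * 1)) =
      (∏ j, x j) * ∏ j, y j := by
    rw [← prod_mul_distrib]; exact prod_congr rfl fun k _ => by ring
  have hone : ∏ j, ((1 - x j * 0) * (1 + τ * 0 + y j * 0)) = 1 :=
    prod_eq_one fun k _ => by ring
  simp only [hprod, hone] at hK0
  rw [Fintype.sum_sum_type] at hinterp
  simp only [prod_erase_inl, prod_erase_inr, Sum.elim_inl, Sum.elim_inr, hKy, hKx] at hinterp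
  have hlhs : 1 - (∏ j, x j) * ∏ k, y k = (0 * 0 + 1 * 1) * K (0, 1) := by
    linear_combination -hK0
  rw [hlhs, hinterp, mul_add]
  congr 1
  · rw [mul_sum, mul_sum]
    refine sum_congr rfl fun b _ => ?_
    have h1 : ∏ k ∈ univ.erase b, bracket (0, 1) (y k, 1) / bracket (y b, 1) (y k, 1) =
        (-1) ^ (Fintype.card ι - 1) * (∏ k ∈ univ.erase b, y k) /
          ∏ k ∈ univ.erase b, (y b - y k) := by
      rw [prod_div_distrib, ← card_univ, ← card_erase_of_mem (mem_univ b), ← prod_neg]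
      congr 1 <;> exact prod_congr rfl fun k _ => by simp [bracket]
    have h2 : ∏ a, bracket (0, 1) (-x a, 1 + τ * x a) / bracket (y b, 1) (-x a, 1 + τ * x a) =
        (∏ a, x a) / ∏ a, (y b + x a + τ * y b * x a) := by
      rw [prod_div_distrib]
      congr 1 <;> exact prod_congr rfl fun k _ => by simp only [bracket]; ring
    rw [h1, h2, residueNumerator, recursionWeight, prod_mul_distrib]
    ring
  · rw [mul_sum, mul_sum]
    refine sum_congr rfl fun a _ => ?_
    have h1 : ∏ k ∈ univ.erase a, bracket (0, 1) (-x k, 1 + τ * x k) /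
        bracket (-x a, 1 + τ * x a) (-x k, 1 + τ * x k) =
        (-1) ^ (Fintype.card ι - 1) * (∏ k ∈ univ.erase a, x k) /
          ∏ k ∈ univ.erase a, (x a - x k) := by
      rw [← card_univ, ← card_erase_of_mem (mem_univ a), ← prod_neg, ← prod_div_distrib]
      refine prod_congr rfl fun k _ => ?_
      rw [neg_div, ← div_neg]
      simp only [bracket]
      congr 1 <;> ring
    have h2 : ∏ b, bracket (0, 1) (y b, 1) / bracket (-x a, 1 + τ * x a) (y b, 1) =
        (∏ b, y b) / ∏ b, (x a + y b + τ * x a * y b) := by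
      rw [← prod_div_distrib]
      refine prod_congr rfl fun k _ => ?_
      rw [← neg_div_neg_eq]
      simp only [bracket]
      congr 1 <;> ring
    rw [h1, h2, residueNumerator, recursionWeight, prod_mul_distrib]
    ring

/-- The recursion for the determinant side of the identity. -/
theorem one_sub_prod_mul_det [Nonempty ι] (τ : F) (x y : ι → F) (hx : Function.Injective x)
    (hy : Function.Injective y) (hxy : ∀ j k, 1 - x j * y k ≠ 0)
    (hw : ∀ j k, x j + y k + τ * x j * y k ≠ 0) {M : Matrix ι ι F}
    (hM : M = Matrix.of fun j k => ((1 - x j * y k) * (x j + y k + τ * x j * y k))⁻¹) :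
    (1 - (∏ j, x j) * ∏ k, y k) * M.det =
      ∑ a, ∑ b, recursionWeight τ x y a * recursionWeight τ y x b *
        (x a + y b + τ * x a * y b) * M.adjugate b a := by
  have hX : ∀ b, ∑ a, M.adjugate b a * (recursionWeight τ x y a * x a) =
      (-1) ^ (Fintype.card ι - 1) * (∏ j, x j) * (M.det * residueNumerator x y b) := by
    intro b
    have h := congrFun (congrArg (fun N => N.mulVec (residueNumerator x y)) M.adjugate_mul) b
    simp only [← Matrix.mulVec_mulVec, Matrix.smul_mulVec, Matrix.one_mulVec, Pi.smul_apply,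
      smul_eq_mul] at h
    rw [← h, Matrix.mulVec, dotProduct, mul_sum]
    refine sum_congr rfl fun a _ => ?_
    rw [recursionWeight_mul_self τ x y hy hxy hw, hM]
    simp only [Matrix.mulVec, dotProduct, Matrix.of_apply]
    ring
  have hY : ∀ a, ∑ b, M.adjugate b a * (recursionWeight τ y x b * y b) =
      (-1) ^ (Fintype.card ι - 1) * (∏ j, y j) * (M.det * residueNumerator y x a) := by
    intro a
    have h := congrFun (congrArg (fun N => N.vecMul (residueNumerator y x)) M.mul_adjugate) a
    simp only [← Matrix.vecMul_vecMul, Matrix.vecMul_smul, Matrix.vecMul_one, Pi.smul_apply,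
      smul_eq_mul] at h
    rw [← h, Matrix.vecMul, dotProduct, mul_sum]
    refine sum_congr rfl fun b _ => ?_
    rw [recursionWeight_mul_self τ y x hx (fun j k => by rw [mul_comm]; exact hxy k j)
      (fun j k => by convert hw k j using 1; ring), hM]
    have : ∀ c, (1 - y b * x c) * (y b + x c + τ * y b * x c) =
      (1 - x c * y b) * (x c + y b + τ * x c * y b) := fun c => by ring
    simp only [Matrix.vecMul, dotProduct, Matrix.of_apply, this]
    simp only [mul_comm (residueNumerator y x _)]
    ring
  have hsplit : ∑ a, ∑ b, recursionWeight τ x y a * recursionWeight τ y x b *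
        (x a + y b + τ * x a * y b) * M.adjugate b a =
      ∑ b, recursionWeight τ y x b * ∑ a, M.adjugate b a * (recursionWeight τ x y a * x a) +
      ∑ a, (1 + τ * x a) * recursionWeight τ x y a *
        ∑ b, M.adjugate b a * (recursionWeight τ y x b * y b) := by
    simp only [mul_sum]
    rw [sum_comm (s := univ) (f := fun b a => recursionWeight τ y x b * _),
      ← sum_add_distrib]
    refine sum_congr rfl fun a _ => ?_
    rw [← sum_add_distrib]
    exact sum_congr rfl fun b _ => by ring
  rw [hsplit, one_sub_prod_mul_prod τ x y hx hy hw]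
  simp only [hX, hY, mul_sum, sum_mul, mul_add, add_mul]
  congr 1 <;> exact sum_congr rfl fun b _ => by ring

end Cauchy

section Permutations

/-- The permutation of `Fin (n + 1)` sending the last element to `a` and acting on the others
as `e`, through the order embedding that omits `a`. -/
def Equiv.Perm.ofLast {n : ℕ} (a : Fin (n + 1)) (e : Equiv.Perm (Fin n)) :
    Equiv.Perm (Fin (n + 1)) :=
  a.cycleRange.symm * Equiv.Perm.decomposeFin.symm (0, e) * finRotate (n + 1)

theorem Equiv.Perm.ofLast_last {n : ℕ} (a : Fin (n + 1)) (e : Equiv.Perm (Fin n)) :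
    Equiv.Perm.ofLast a e (Fin.last n) = a := by
  simp [Equiv.Perm.ofLast]

theorem Equiv.Perm.ofLast_castSucc {n : ℕ} (a : Fin (n + 1)) (e : Equiv.Perm (Fin n))
    (i : Fin n) : Equiv.Perm.ofLast a e i.castSucc = a.succAbove (e i) := by
  simp [Equiv.Perm.ofLast]

theorem Equiv.Perm.sign_ofLast {n : ℕ} (a : Fin (n + 1)) (e : Equiv.Perm (Fin n)) :
    Equiv.Perm.sign (Equiv.Perm.ofLast a e) =
      (-1) ^ (a : ℕ) * Equiv.Perm.sign e * (-1) ^ n := by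
  simp [Equiv.Perm.ofLast, Equiv.Perm.decomposeFin.symm_sign, sign_finRotate]

theorem Equiv.Perm.sum_ofLast {n : ℕ} {M : Type*} [AddCommMonoid M]
    (f : Equiv.Perm (Fin (n + 1)) → M) :
    ∑ σ, f σ = ∑ a : Fin (n + 1), ∑ e : Equiv.Perm (Fin n), f (Equiv.Perm.ofLast a e) := by
  rw [← Fintype.sum_prod_type']
  refine (Function.Bijective.sum_comp
    (e := fun p : Fin (n + 1) × Equiv.Perm (Fin n) => Equiv.Perm.ofLast p.1 p.2) ?_ f).symm
  rw [Fintype.bijective_iff_injective_and_card]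
  refine ⟨?_, by simp [Fintype.card_perm, Nat.factorial_succ]⟩
  rintro ⟨a, e⟩ ⟨b, e'⟩ h
  simp only at h
  have hab : a = b := by
    rw [← Equiv.Perm.ofLast_last a e, h, Equiv.Perm.ofLast_last]
  subst hab
  refine Prod.ext rfl (Equiv.ext fun i => a.succAbove_right_injective ?_)
  rw [← Equiv.Perm.ofLast_castSucc, h, Equiv.Perm.ofLast_castSucc]

theorem Equiv.Perm.sum_sign_mul_eq_zero {ι : Type*} [Fintype ι] [DecidableEq ι] {R α : Type*}
    [CommRing R] (x : ι → α) (hx : ¬ Function.Injective x) (f : (ι → α) → R) :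
    ∑ σ : Equiv.Perm ι, ((Equiv.Perm.sign σ : ℤ) : R) * f (x ∘ σ) = 0 := by
  simp only [Function.Injective, not_forall] at hx
  obtain ⟨i, j, hij, hne⟩ := hx
  have hswap : x ∘ Equiv.swap i j = x := by
    ext k
    simp only [Function.comp_apply, Equiv.swap_apply_def]
    split_ifs with h1 h2
    · rw [h1, hij]
    · rw [h2, hij]
    · rfl
  refine sum_involution (fun σ _ => Equiv.swap i j * σ) (fun σ _ => ?_) (fun σ _ _ h => ?_)
    (fun _ _ => mem_univ _) fun σ _ => by simp
  · rw [Equiv.Perm.coe_mul, ← Function.comp_assoc, hswap, Equiv.Perm.sign_mul,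
      Equiv.Perm.sign_swap hne]
    simp
  · exact hne (Equiv.swap_eq_one_iff.mp (mul_eq_right.mp h))

end Permutations

theorem Fin.prod_Ioi_castSucc_eq_mul_last {n : ℕ} {M : Type*} [CommMonoid M]
    (f : Fin (n + 1) → M) (i : Fin n) :
    ∏ k ∈ Ioi i.castSucc, f k = (∏ k ∈ Ioi i, f k.castSucc) * f (Fin.last n) := by
  have hlast : Fin.last n ∉ (Ioi i).map Fin.castSuccEmb := by simp
  have : Ioi i.castSucc = Finset.cons (Fin.last n) ((Ioi i).map Fin.castSuccEmb) hlast := by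
    ext k
    induction k using Fin.lastCases <;> simp [Fin.castSucc_lt_last, Fin.le_last]
  rw [this, Finset.prod_cons, prod_map, mul_comm]
  rfl

theorem Fin.prod_erase_univ_succAbove {n : ℕ} {M : Type*} [CommMonoid M] (f : Fin (n + 1) → M)
    (a : Fin (n + 1)) : ∏ j ∈ univ.erase a, f j = ∏ i : Fin n, f (a.succAbove i) := by
  have : univ.erase a = univ.map a.succAboveEmb := by
    ext k
    simp [Fin.exists_succAbove_eq_iff]
  rw [this, prod_map]
  rfl

section DoubleAntisymmetrization

variable {F : Type*} [Field F]

/-- The function that is antisymmetrized. -/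
def antisymSummand (s : ℕ) (τ : F) (x y : Fin s → F) : F :=
  (∏ j : Fin s, (x j * y j) ^ (s - (j.val + 1)) / (1 - ∏ l ∈ Iic j, x l * y l)) *
    ∏ j : Fin s, ∏ k ∈ Ioi j, ((x j * x k + τ * x k + 1) * (y j * y k + τ * y k + 1))

/-- The double antisymmetrization. -/
def doubleAntisym (s : ℕ) (τ : F) (x y : Fin s → F) : F :=
  ∑ σ : Equiv.Perm (Fin s), ∑ ρ : Equiv.Perm (Fin s),
    ((Equiv.Perm.sign σ : ℤ) : F) * ((Equiv.Perm.sign ρ : ℤ) : F) *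
      antisymSummand s τ (x ∘ σ) (y ∘ ρ)

theorem antisymSummand_succ (n : ℕ) (τ : F) (x y : Fin (n + 1) → F) :
    antisymSummand (n + 1) τ x y = (1 - (∏ j, x j) * ∏ j, y j)⁻¹ *
      ((∏ i : Fin n, x i.castSucc * (x i.castSucc * x (Fin.last n) + τ * x (Fin.last n) + 1)) *
       (∏ i : Fin n, y i.castSucc * (y i.castSucc * y (Fin.last n) + τ * y (Fin.last n) + 1))) *
      antisymSummand n τ (x ∘ Fin.castSucc) (y ∘ Fin.castSucc) := by
  have hIic : Iic (Fin.last n) = univ := by ext k; simp [Fin.le_last]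
  have hIoi : Ioi (Fin.last n) = ∅ := by ext k; simp [Fin.le_last]
  have hpow : ∀ i : Fin n, n + 1 - (i.val + 1) = (n - (i.val + 1)) + 1 := by
    intro i; have := i.isLt; omega
  simp only [antisymSummand]
  rw [Fin.prod_univ_castSucc, Fin.prod_univ_castSucc (fun j => ∏ k ∈ Ioi j, _), hIic, hIoi]
  simp only [Fin.prod_Iic_castSucc, Fin.prod_Ioi_castSucc_eq_mul_last, Fin.val_castSucc,
    Fin.val_last, prod_empty, mul_one, Nat.sub_self, pow_zero, hpow, pow_succ, Function.comp_apply,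
    prod_div_distrib, prod_mul_distrib]
  ring

theorem doubleAntisym_succ (n : ℕ) (τ : F) (x y : Fin (n + 1) → F) :
    doubleAntisym (n + 1) τ x y = (1 - (∏ j, x j) * ∏ j, y j)⁻¹ *
      ∑ a : Fin (n + 1), ∑ b : Fin (n + 1), (-1) ^ ((a : ℕ) + b) *
        ((∏ j ∈ univ.erase a, x j * (x j * x a + τ * x a + 1)) *
          ∏ k ∈ univ.erase b, y k * (y k * y b + τ * y b + 1)) *
        doubleAntisym n τ (x ∘ a.succAbove) (y ∘ b.succAbove) := by
  have hcomp : ∀ (z : Fin (n + 1) → F) (a : Fin (n + 1)) (e : Equiv.Perm (Fin n)),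
      (z ∘ Equiv.Perm.ofLast a e) ∘ Fin.castSucc = (z ∘ a.succAbove) ∘ e := by
    intro z a e
    ext i
    simp [Equiv.Perm.ofLast_castSucc]
  have hprod : ∀ (z : Fin (n + 1) → F) (σ : Equiv.Perm (Fin (n + 1))),
      ∏ j, (z ∘ σ) j = ∏ j, z j := fun z σ => Equiv.prod_comp σ z
  have hweight : ∀ (z : Fin (n + 1) → F) (a : Fin (n + 1)) (e : Equiv.Perm (Fin n)),
      ∏ i : Fin n, z (a.succAbove (e i)) * (z (a.succAbove (e i)) * z a + τ * z a + 1) =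
      ∏ j ∈ univ.erase a, z j * (z j * z a + τ * z a + 1) := by
    intro z a e
    rw [Fin.prod_erase_univ_succAbove,
      Equiv.prod_comp e fun i => z (a.succAbove i) * (z (a.succAbove i) * z a + τ * z a + 1)]
  have hsign : ((-1 : F) ^ n) * (-1) ^ n = 1 := by rw [← mul_pow]; simp
  simp only [doubleAntisym, Equiv.Perm.sum_ofLast (n := n), antisymSummand_succ, hcomp, hprod]
  simp only [Function.comp_apply, Equiv.Perm.ofLast_last, Equiv.Perm.ofLast_castSucc, hweight,
    Equiv.Perm.sign_ofLast, mul_sum]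
  refine sum_congr rfl fun a _ => ?_
  rw [sum_comm]
  refine sum_congr rfl fun b _ => sum_congr rfl fun σ _ => sum_congr rfl fun ρ _ => ?_
  push_cast
  rw [pow_add]
  generalize (-1 : F) ^ n = ε at hsign
  generalize (1 - (∏ j, x j) * ∏ j, y j)⁻¹ = c
  generalize (∏ j ∈ univ.erase a, x j * (x j * x a + τ * x a + 1)) = p
  generalize (∏ k ∈ univ.erase b, y k * (y k * y b + τ * y b + 1)) = q
  generalize antisymSummand n τ _ _ = t
  linear_combination ((-1) ^ (a : ℕ) * (Equiv.Perm.sign σ : ℤ) * ((-1) ^ (b : ℕ) *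
    (Equiv.Perm.sign ρ : ℤ)) * c * p * q * t) * hsign

theorem doubleAntisym_eq_zero_left (s : ℕ) (τ : F) (x y : Fin s → F)
    (hx : ¬ Function.Injective x) : doubleAntisym s τ x y = 0 := by
  rw [doubleAntisym, sum_comm]
  refine sum_eq_zero fun ρ _ => ?_
  simp only [mul_assoc]
  exact Equiv.Perm.sum_sign_mul_eq_zero x hx
    fun z => ((Equiv.Perm.sign ρ : ℤ) : F) * antisymSummand s τ z (y ∘ ρ)

theorem doubleAntisym_eq_zero_right (s : ℕ) (τ : F) (x y : Fin s → F)
    (hy : ¬ Function.Injective y) : doubleAntisym s τ x y = 0 := by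
  refine sum_eq_zero fun σ _ => ?_
  simp only [mul_assoc, ← mul_sum]
  rw [Equiv.Perm.sum_sign_mul_eq_zero y hy fun z => antisymSummand s τ (x ∘ σ) z, mul_zero]

theorem doubleAntisym_eq (s : ℕ) (τ : F) (x y : Fin s → F)
    (hxy : ∀ j k, 1 - x j * y k ≠ 0) (hw : ∀ j k, x j + y k + τ * x j * y k ≠ 0)
    (hprod : ∀ S T : Finset (Fin s), S.Nonempty → S.card = T.card →
      1 - (∏ j ∈ S, x j) * (∏ j ∈ T, y j) ≠ 0) :
    doubleAntisym s τ x y = (∏ j : Fin s, ∏ k : Fin s, (x j + y k + τ * x j * y k)) *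
      Matrix.det (Matrix.of fun j k : Fin s =>
        ((1 - x j * y k) * (x j + y k + τ * x j * y k))⁻¹) := by
  induction s with
  | zero => simp [doubleAntisym, antisymSummand]
  | succ n ih =>
    by_cases hx : Function.Injective x
    swap
    · rw [doubleAntisym_eq_zero_left _ _ _ _ hx]
      simp only [Function.Injective, not_forall] at hx
      obtain ⟨i, j, hij, hne⟩ := hx
      rw [Matrix.det_zero_of_row_eq hne (by ext k; simp [hij]), mul_zero]
    by_cases hy : Function.Injective y
    swap
    · rw [doubleAntisym_eq_zero_right _ _ _ _ hy]
      simp only [Function.Injective, not_forall] at hy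
      obtain ⟨i, j, hij, hne⟩ := hy
      rw [Matrix.det_zero_of_column_eq hne (by intro k; simp [hij]), mul_zero]
    have hne := hprod univ univ univ_nonempty rfl
    rw [doubleAntisym_succ, inv_mul_eq_iff_eq_mul₀ hne, mul_left_comm,
      one_sub_prod_mul_det τ x y hx hy hxy hw rfl, mul_sum]
    refine sum_congr rfl fun a _ => ?_
    rw [mul_sum]
    refine sum_congr rfl fun b _ => ?_
    rw [ih (x ∘ a.succAbove) (y ∘ b.succAbove) (fun j k => hxy _ _) (fun j k => hw _ _)
      fun S T hS hST => by
        simpa using hprod (S.map a.succAboveEmb) (T.map b.succAboveEmb) (by simpa using hS)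
          (by simpa using hST),
      Matrix.adjugate_fin_succ_eq_det_submatrix]
    have hsub : (Matrix.of fun j k : Fin (n + 1) =>
        ((1 - x j * y k) * (x j + y k + τ * x j * y k))⁻¹).submatrix a.succAbove b.succAbove =
        Matrix.of fun j k : Fin n =>
          ((1 - (x ∘ a.succAbove) j * (y ∘ b.succAbove) k) * ((x ∘ a.succAbove) j +
            (y ∘ b.succAbove) k + τ * (x ∘ a.succAbove) j * (y ∘ b.succAbove) k))⁻¹ := rfl
    rw [hsub]
    generalize Matrix.det (n := Fin n) (R := F) _ = D
    have hW : ∏ j, ∏ k, (x j + y k + τ * x j * y k) =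
        (∏ k, (x a + y k + τ * x a * y k)) * ((∏ i : Fin n, (x (a.succAbove i) + y b +
          τ * x (a.succAbove i) * y b)) * ∏ i : Fin n, ∏ k : Fin n, (x (a.succAbove i) +
            y (b.succAbove k) + τ * x (a.succAbove i) * y (b.succAbove k))) := by
      rw [Fin.prod_univ_succAbove _ a, ← prod_mul_distrib]
      congr 1
      exact prod_congr rfl fun i _ => Fin.prod_univ_succAbove _ b
    have hV : ∏ j, (y b + x j + τ * y b * x j) = (x a + y b + τ * x a * y b) *
        ∏ i : Fin n, (x (a.succAbove i) + y b + τ * x (a.succAbove i) * y b) := by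
      rw [Fin.prod_univ_succAbove _ a]
      congr 1
      · ring
      · exact prod_congr rfl fun i _ => by ring
    have h1 : ∏ k, (x a + y k + τ * x a * y k) ≠ 0 := prod_ne_zero_iff.mpr fun k _ => hw a k
    have h2 : ∏ i : Fin n, (x (a.succAbove i) + y b + τ * x (a.succAbove i) * y b) ≠ 0 :=
      prod_ne_zero_iff.mpr fun i _ => hw _ b
    have h3 := hw a b
    rw [hW, recursionWeight, recursionWeight, hV]
    simp only [Function.comp_apply]
    generalize ∏ k, (x a + y k + τ * x a * y k) = p at *
    generalize ∏ i : Fin n, (x (a.succAbove i) + y b + τ * x (a.succAbove i) * y b) = q at *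
    generalize x a + y b + τ * x a * y b = w at *
    field_simp

end DoubleAntisymmetrization

/-- Double antisymmetrization identity of Cantini–Colomo–Pronko:
the double antisymmetrization in the `x`'s and the `y`'s of
`∏_j (x_j y_j)^{s-j}/(1-∏_{l≤j} x_l y_l) · ∏_{j<k}(x_jx_k+τx_k+1)(y_jy_k+τy_k+1)`
equals `∏_{j,k}(x_j+y_k+τx_jy_k) · det[ψ(x_j,y_k)]`, with
`ψ(x,y) = 1/((1-xy)(x+y+τxy))`. -/
theorem stmt6 (s : ℕ) (hs : 1 ≤ s) (F : Type*) [Field F] (τ : F) (x y : Fin s → F)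
    (hxy : ∀ j k, 1 - x j * y k ≠ 0)
    (hxyt : ∀ j k, x j + y k + τ * x j * y k ≠ 0)
    (hprod : ∀ S T : Finset (Fin s), S.Nonempty → S.card = T.card →
      1 - (∏ j ∈ S, x j) * (∏ j ∈ T, y j) ≠ 0) :
    ∑ σ : Equiv.Perm (Fin s), ∑ ρ : Equiv.Perm (Fin s),
        ((Equiv.Perm.sign σ : ℤ) : F) * ((Equiv.Perm.sign ρ : ℤ) : F) *
          ((∏ j : Fin s,
              (x (σ j) * y (ρ j)) ^ (s - (j.val + 1)) /
                (1 - ∏ l ∈ Iic j, x (σ l) * y (ρ l))) *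
            ∏ j : Fin s, ∏ k ∈ Ioi j,
              ((x (σ j) * x (σ k) + τ * x (σ k) + 1) *
                (y (ρ j) * y (ρ k) + τ * y (ρ k) + 1))) =
      (∏ j : Fin s, ∏ k : Fin s, (x j + y k + τ * x j * y k)) *
        Matrix.det (Matrix.of fun j k : Fin s =>
          ((1 - x j * y k) * (x j + y k + τ * x j * y k))⁻¹) := by
  exact doubleAntisym_eq s τ x y hxy hxyt hprod
end
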